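/- Let E be a reflexive Banach space and let Ψ, Φ : E → ℝ be C¹ functionals. Assume Ψ satisfies (Ψ1), (Ψ2) and (Ψ4), and assume Φ is weakly (sequentially) upper semicontinuous and satisfies (Φ2) and (Φ3). Then the function φ : [0,∞) → ℝ defined by φ(r) = max_{u ∈ ∂Ã_r} Φ(u) for r > 0 and φ(0) = Φ(0) is continuous. -/

import Mathlib

open Filter Topology Set

variable {E : Type*}

/-- Weak (sequential) convergence in a normed space: `u n ⇀ u₀` iff `f (u n) → f u₀`
for every continuous linear functional `f`. -/
def WeakConv [NormedAddCommGroup E] [NormedSpace ℝ E] (u : ℕ → E) (u₀ : E) : Prop :=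
  ∀ f : E →L[ℝ] ℝ, Tendsto (fun n => f (u n)) atTop (𝓝 (f u₀))

/-- Bounded sequences in a reflexive normed space have weakly convergent subsequences. -/
theorem exists_weakConv_subseq [NormedAddCommGroup E] [NormedSpace ℝ E]
    (hrefl : Function.Surjective (NormedSpace.inclusionInDoubleDual ℝ E))
    {u : ℕ → E} {R : ℝ} (hu : ∀ n, ‖u n‖ ≤ R) :
    ∃ (u₀ : E) (φ : ℕ → ℕ), StrictMono φ ∧ WeakConv (u ∘ φ) u₀ := by
  set F : Submodule ℝ E := (Submodule.span ℝ (range u)).topologicalClosure with hF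
  have hFsep : TopologicalSpace.IsSeparable (F : Set E) := by
    rw [hF, Submodule.topologicalClosure_coe]
    exact (TopologicalSpace.IsSeparable.span (countable_range u).isSeparable).closure
  have : TopologicalSpace.SeparableSpace F := hFsep.separableSpace
  have hFclosed : IsClosed (F : Set E) := Submodule.isClosed_topologicalClosure _
  set S : Set E := Metric.closedBall 0 R ∩ F
  have hSconv : Convex ℝ S := (convex_closedBall 0 R).inter F.convex
  have hSclosed : IsClosed S := Metric.isClosed_closedBall.inter hFclosed
  have hK : IsCompact (toWeakSpace ℝ E '' S) := by
    rw [← hSclosed.closure_eq, hSconv.toWeakSpace_closure ℝ]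
    apply NormedSpace.isCompact_closure_of_isBounded
    · rw [preimage_image_eq _ (toWeakSpace ℝ E).injective]
      exact Metric.isBounded_closedBall.subset inter_subset_left
    · intro x _
      obtain ⟨y, hy⟩ := hrefl (WeakDual.toStrongDual x)
      exact ⟨toWeakSpace ℝ E y, hy⟩
  choose g hg_norm hg_apply using
    fun k => exists_dual_vector'' ℝ (TopologicalSpace.denseSeq F k : E)
  have hg_sep : ∀ z ∈ F, (∀ k, g k z = 0) → z = 0 := by
    intro z hz h
    by_contra hne
    have hpos : 0 < ‖z‖ / 2 := half_pos (norm_pos_iff.2 hne)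
    obtain ⟨k, hk⟩ := (TopologicalSpace.denseRange_denseSeq F).exists_dist_lt ⟨z, hz⟩ hpos
    set x : E := (TopologicalSpace.denseSeq F k : E)
    have hk' : ‖z - x‖ < ‖z‖ / 2 := by
      rw [← dist_eq_norm]
      exact hk
    have h1 : ‖x‖ ≤ ‖z - x‖ := by
      have h2 : ‖g k (z - x)‖ ≤ 1 * ‖z - x‖ := (g k).le_of_opNorm_le (hg_norm k) _
      have h3 : g k x = ‖x‖ := hg_apply k
      rw [map_sub, h k, h3, zero_sub, norm_neg, one_mul] at h2
      simpa using h2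
    have h4 : ‖z‖ ≤ ‖z - x‖ + ‖x‖ := by simpa using norm_add_le (z - x) x
    linarith
  have heval (f : E →L[ℝ] ℝ) : Continuous fun x : WeakSpace ℝ E => f ((toWeakSpace ℝ E).symm x) :=
    WeakBilin.eval_continuous (topDualPairing ℝ E).flip f
  have : CompactSpace (toWeakSpace ℝ E '' S) := isCompact_iff_compactSpace.1 hK
  have : TopologicalSpace.MetrizableSpace (toWeakSpace ℝ E '' S) := by
    refine Metric.PiNatEmbed.TopologicalSpace.MetrizableSpace.of_countable_separating
      (fun n x => g n ((toWeakSpace ℝ E).symm x.1))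
      (fun n => (heval (g n)).comp continuous_subtype_val) ?_
    rintro ⟨_, a, ha, rfl⟩ ⟨_, b, hb, rfl⟩ hab
    contrapose! hab
    have : a - b = 0 := hg_sep _ (F.sub_mem ha.2 hb.2) fun k => by
      simpa [sub_eq_zero] using hab k
    exact Subtype.ext (congrArg (toWeakSpace ℝ E) (sub_eq_zero.1 this))
  have huS n : u n ∈ S := ⟨by simpa using hu n,
    Submodule.le_topologicalClosure _ (Submodule.subset_span (mem_range_self n))⟩
  obtain ⟨x, φ, hφ, hlim⟩ := CompactSpace.tendsto_subseq
    fun n => (⟨toWeakSpace ℝ E (u n), mem_image_of_mem _ (huS n)⟩ : toWeakSpace ℝ E '' S)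
  exact ⟨(toWeakSpace ℝ E).symm x.1, φ, hφ, fun f =>
    (((heval f).comp continuous_subtype_val).tendsto x).comp hlim⟩

section Sublevel

variable [NormedAddCommGroup E] [NormedSpace ℝ E] {Ψ Φ : E → ℝ}

/-- If `Ψ (u n)` is bounded above by a convergent sequence, then, for `Ψ` coercive and weakly lower
semicontinuous, a subsequence of `u` converges weakly to a point of the limiting sublevel set. -/
theorem exists_weakConv_subseq_sublevel
    (hrefl : Function.Surjective (NormedSpace.inclusionInDoubleDual ℝ E))
    (hcoer : Tendsto Ψ (Bornology.cobounded E) atTop)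
    (hwlsc : ∀ (u : ℕ → E) (u₀ : E), WeakConv u u₀ →
      ∀ ε > (0:ℝ), ∀ᶠ n in atTop, Ψ u₀ - ε < Ψ (u n))
    {u : ℕ → E} {r : ℕ → ℝ} {r₀ : ℝ} (hr : Tendsto r atTop (𝓝 r₀)) (hu : ∀ n, Ψ (u n) ≤ r n) :
    ∃ (u₀ : E) (φ : ℕ → ℕ), StrictMono φ ∧ WeakConv (u ∘ φ) u₀ ∧ Ψ u₀ ≤ r₀ := by
  obtain ⟨B, hB⟩ := hr.bddAbove_range
  have hbdd : Bornology.IsBounded {v : E | Ψ v ≤ B} := by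
    rw [← Bornology.isCobounded_compl_iff, Bornology.isCobounded_def]
    filter_upwards [hcoer.eventually_gt_atTop B] with v hv using not_le.2 hv
  obtain ⟨R, hR⟩ := hbdd.exists_norm_le
  obtain ⟨u₀, φ, hφ, hw⟩ := exists_weakConv_subseq hrefl
    fun n => hR (u n) ((hu n).trans (hB (mem_range_self n)))
  refine ⟨u₀, φ, hφ, hw, le_of_forall_pos_le_add fun ε hε => ?_⟩
  refine ge_of_tendsto ((hr.comp hφ.tendsto_atTop).add_const ε) ?_
  filter_upwards [hwlsc _ _ hw ε hε] with n hn
  have := hu (φ n)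
  simp only [Function.comp_apply] at hn ⊢
  linarith

/-- A weakly upper semicontinuous functional attains its maximum on nonempty sublevel sets of a
coercive weakly lower semicontinuous functional. -/
theorem exists_isMaxOn_sublevel
    (hrefl : Function.Surjective (NormedSpace.inclusionInDoubleDual ℝ E))
    (hcoer : Tendsto Ψ (Bornology.cobounded E) atTop)
    (hwlsc : ∀ (u : ℕ → E) (u₀ : E), WeakConv u u₀ →
      ∀ ε > (0:ℝ), ∀ᶠ n in atTop, Ψ u₀ - ε < Ψ (u n))
    (hwusc : ∀ (u : ℕ → E) (u₀ : E), WeakConv u u₀ →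
      ∀ ε > (0:ℝ), ∀ᶠ n in atTop, Φ (u n) < Φ u₀ + ε)
    {r : ℝ} (hne : {u : E | Ψ u ≤ r}.Nonempty) :
    ∃ u₀, Ψ u₀ ≤ r ∧ IsMaxOn Φ {u : E | Ψ u ≤ r} u₀ := by
  set A := (fun u => Real.arctan (Φ u)) '' {u : E | Ψ u ≤ r}
  have hbdd : BddAbove A := ⟨Real.pi / 2, by
    rintro _ ⟨u, -, rfl⟩
    exact (Real.arctan_lt_pi_div_two _).le⟩
  obtain ⟨a, -, ha, haA⟩ := exists_seq_tendsto_sSup (hne.image _) hbdd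
  choose u hu hua using haA
  obtain ⟨u₀, φ, hφ, hw, hu₀⟩ :=
    exists_weakConv_subseq_sublevel hrefl hcoer hwlsc (tendsto_const_nhds (x := r)) hu
  have hsup : ∀ ε > 0, sSup A ≤ Real.arctan (Φ u₀ + ε) := fun ε hε => by
    refine le_of_tendsto (ha.comp hφ.tendsto_atTop) ?_
    filter_upwards [hwusc _ _ hw ε hε] with n hn
    rw [Function.comp_apply, ← hua]
    exact (Real.arctan_strictMono hn).le
  have hle : sSup A ≤ Real.arctan (Φ u₀) := by
    have hlim : Tendsto (fun ε => Real.arctan (Φ u₀ + ε)) (𝓝[>] 0) (𝓝 (Real.arctan (Φ u₀))) := by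
      have : Continuous fun ε => Real.arctan (Φ u₀ + ε) := by fun_prop
      simpa using (this.tendsto 0).mono_left nhdsWithin_le_nhds
    exact ge_of_tendsto hlim (eventually_nhdsWithin_of_forall hsup)
  exact ⟨u₀, hu₀, fun v hv => Real.arctan_strictMono.le_iff_le.1
    ((le_csSup hbdd (mem_image_of_mem _ hv)).trans hle)⟩

end Sublevel

/-- Continuity of `φ`, where `φ(r) = max_(u ∈ ∂Ã_r) Φ(u)` for `r > 0` and `φ(0) = Φ(0)`. -/
theorem varphi_continuous [NormedAddCommGroup E] [NormedSpace ℝ E] [CompleteSpace E]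
    (hrefl : Function.Surjective (NormedSpace.inclusionInDoubleDual ℝ E))
    (Ψ Φ : E → ℝ) (hΨC1 : ContDiff ℝ 1 Ψ) (hΦC1 : ContDiff ℝ 1 Φ)
    -- (Ψ1): Ψ is convex, coercive and weakly (sequentially) lower semicontinuous
    (hΨconv : ConvexOn ℝ Set.univ Ψ)
    (hΨcoer : Tendsto Ψ (Bornology.cobounded E) atTop)
    (hΨwlsc : ∀ (u : ℕ → E) (u₀ : E), WeakConv u u₀ →
      ∀ ε > (0:ℝ), ∀ᶠ n in atTop, Ψ u₀ - ε < Ψ (u n))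
    -- (Ψ2): Ã₀ = {0} and 0 ∈ int Ã_r for every r > 0
    (hΨ2a : {u : E | Ψ u ≤ 0} = {0})
    (hΨ2b : ∀ r > (0:ℝ), (0:E) ∈ interior {u : E | Ψ u ≤ r})
    -- (Ψ4): for every u ≠ 0 and r > 0 there is a unique t > 0 with t • u ∈ ∂Ã_r
    (hΨ4 : ∀ u : E, u ≠ 0 → ∀ r > (0:ℝ), ∃! t : ℝ, 0 < t ∧ Ψ (t • u) = r)
    -- Φ is weakly (sequentially) upper semicontinuous
    (hΦwusc : ∀ (u : ℕ → E) (u₀ : E), WeakConv u u₀ →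
      ∀ ε > (0:ℝ), ∀ᶠ n in atTop, Φ (u n) < Φ u₀ + ε)
    -- (Φ2): critical points of Φ have nonpositive Φ-value
    (hΦ2 : ∀ u : E, fderiv ℝ Φ u = 0 → Φ u ≤ 0)
    -- (Φ3): there is a sequence vₙ → 0 with Φ(vₙ) > 0
    (hΦ3 : ∃ v : ℕ → E, Tendsto v atTop (𝓝 0) ∧ ∀ n, 0 < Φ (v n))
    :
    ContinuousOn (fun r : ℝ => if r = 0 then Φ 0 else sSup (Φ '' {u : E | Ψ u = r}))
      (Set.Ici 0) := by
  have hΨ0 : Ψ 0 ≤ 0 := by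
    have : (0:E) ∈ {u : E | Ψ u ≤ 0} := by simp [hΨ2a]
    exact this
  set f : ℝ → ℝ := fun r => if r = 0 then Φ 0 else sSup (Φ '' {u : E | Ψ u = r}) with hf
  have key : ∀ r, 0 ≤ r → ∃ u, Ψ u ≤ r ∧ f r = Φ u ∧ ∀ v, Ψ v ≤ r → Φ v ≤ Φ u := by
    intro r hr
    obtain ⟨u, hur, hmax⟩ := exists_isMaxOn_sublevel hrefl hΨcoer hΨwlsc hΦwusc
      (r := r) ⟨0, hΨ0.trans hr⟩
    refine ⟨u, hur, ?_, fun v hv => hmax hv⟩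
    rcases hr.eq_or_lt with rfl | hr
    · have : u ∈ {u : E | Ψ u ≤ 0} := hur
      rw [hΨ2a] at this
      simp [hf, mem_singleton_iff.1 this]
    have hpos : 0 < Φ u := by
      obtain ⟨v, hv, hvpos⟩ := hΦ3
      obtain ⟨n, hn⟩ := (hv.eventually (mem_interior_iff_mem_nhds.1 (hΨ2b r hr))).exists
      exact (hvpos n).trans_le (hmax hn)
    have hbd : Ψ u = r := by
      refine hur.eq_of_not_lt fun hlt => ?_
      have hloc : IsLocalMax Φ u := by
        filter_upwards [hΨC1.continuous.continuousAt.eventually_lt_const hlt] with v hv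
        exact hmax hv.le
      exact hpos.not_ge (hΦ2 u hloc.fderiv_eq_zero)
    have hgr : IsGreatest (Φ '' {u : E | Ψ u = r}) (Φ u) := by
      refine ⟨mem_image_of_mem _ hbd, ?_⟩
      rintro _ ⟨v, hv, rfl⟩
      exact hmax (le_of_eq hv)
    simp only [hf, if_neg hr.ne', hgr.csSup_eq]
  intro r₀ hr₀
  obtain ⟨u₀, hu₀, hfu₀, hmax₀⟩ := key r₀ hr₀
  refine tendsto_order.2 ⟨fun a ha => ?_, fun b hb => ?_⟩
  · rcases (mem_Ici.1 hr₀).eq_or_lt with rfl | hpos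
    · filter_upwards [self_mem_nhdsWithin] with r hr
      obtain ⟨u, -, hfu, hmax⟩ := key r hr
      rw [hfu]
      refine lt_of_lt_of_le ?_ (hmax 0 (hΨ0.trans hr))
      simpa [hf] using ha
    have hlim : Tendsto (fun t : ℝ => Φ (t • u₀)) (𝓝[<] 1) (𝓝 (Φ u₀)) := by
      have : Continuous fun t : ℝ => Φ (t • u₀) := hΦC1.continuous.comp (by fun_prop)
      simpa using (this.tendsto 1).mono_left nhdsWithin_le_nhds
    obtain ⟨t, hta, ht0, ht1⟩ := ((hlim.eventually_const_lt (hfu₀ ▸ ha)).and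
      (Ioo_mem_nhdsLT zero_lt_one)).exists
    have hlt : Ψ (t • u₀) < r₀ := by
      have := hΨconv.2 (mem_univ u₀) (mem_univ 0) ht0.le (sub_nonneg.2 ht1.le)
        (add_sub_cancel t 1)
      simp only [smul_zero, add_zero, smul_eq_mul] at this
      nlinarith [mul_nonneg ht0.le (sub_nonneg.2 hu₀),
        mul_nonneg (sub_nonneg.2 ht1.le) (neg_nonneg.2 hΨ0), mul_pos (sub_pos.2 ht1) hpos]
    filter_upwards [self_mem_nhdsWithin, mem_nhdsWithin_of_mem_nhds (lt_mem_nhds hlt)]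
      with r hr hlt'
    obtain ⟨u, -, hfu, hmax⟩ := key r hr
    exact hfu ▸ hta.trans_le (hmax _ (le_of_lt hlt'))
  · by_contra hnot
    obtain ⟨r, hrlim, hr⟩ := exists_seq_forall_of_frequently
      ((not_eventually.1 hnot).and_eventually self_mem_nhdsWithin)
    choose u hur hfu _ using fun n => key (r n) (hr n).2
    obtain ⟨w, φ, -, hw, hΨw⟩ := exists_weakConv_subseq_sublevel hrefl hΨcoer hΨwlsc
      (hrlim.mono_right nhdsWithin_le_nhds) hur
    have hbw : b ≤ Φ w := le_of_forall_pos_le_add fun ε hε => by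
      obtain ⟨n, hn⟩ := (hΦwusc _ _ hw ε hε).exists
      exact ((not_lt.1 (hr (φ n)).1).trans_eq (hfu (φ n))).trans hn.le
    exact (hb.trans_le hbw).not_ge (hfu₀ ▸ hmax₀ w hΨw)
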